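/- Let M be a finite von Neumann algebra with a faithful normal tracial state τ (e.g., a II₁ factor), and let x, y ∈ M be normal elements such that x lies in the weak* (or norm) closure of the convex hull of the unitary orbit of y and vice versa. Then τ(f(x)) = τ(f(y)) for every continuous function f on a compact set containing both spectra; in particular sp(x) = sp(y) and the spectral distribution measures of x and y with respect to τ coincide. -/

import Mathlib

open scoped ComplexOrder

section TraceAux

variable {H : Type*} [NormedAddCommGroup H] [InnerProductSpace ℂ H] [CompleteSpace H]

/-- The square of the trace seminorm. -/
noncomputable def trq (τ : (H →L[ℂ] H) →ₗ[ℂ] ℂ) (a : H →L[ℂ] H) : ℝ := (τ (star a * a)).re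

lemma trq_nonneg (τ : (H →L[ℂ] H) →ₗ[ℂ] ℂ) (hpos : ∀ a, 0 ≤ τ (star a * a)) (a : H →L[ℂ] H) :
    0 ≤ trq τ a := (Complex.le_def.1 (hpos a)).1

lemma tr_star (τ : (H →L[ℂ] H) →ₗ[ℂ] ℂ) (hpos : ∀ a, 0 ≤ τ (star a * a)) (a : H →L[ℂ] H) :
    τ (star a) = star (τ a) := by
  have h0 := (Complex.le_def.1 (hpos a)).2
  have h1 := (Complex.le_def.1 (hpos 1)).2
  have h2 := (Complex.le_def.1 (hpos (1 + a))).2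
  have h3 := (Complex.le_def.1 (hpos (1 + Complex.I • a))).2
  simp only [star_add, star_one, star_smul, mul_add, add_mul, one_mul, mul_one, map_add,
    map_smul, smul_mul_assoc, mul_smul_comm, smul_eq_mul, Complex.star_def, Complex.conj_I,
    Complex.add_im, Complex.mul_im, Complex.mul_re, Complex.I_re, Complex.I_im, Complex.neg_re, Complex.neg_im,
    Complex.zero_im] at h0 h1 h2 h3
  apply Complex.ext
  · simp only [Complex.star_def, Complex.conj_re]; linarith
  · simp only [Complex.star_def, Complex.conj_im]; linarith

lemma trq_add_le (τ : (H →L[ℂ] H) →ₗ[ℂ] ℂ) (hpos : ∀ a, 0 ≤ τ (star a * a))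
    (a b : H →L[ℂ] H) : trq τ (a + b) ≤ 2 * trq τ a + 2 * trq τ b := by
  have h := trq_nonneg τ hpos (a - b)
  simp only [trq, star_add, star_sub, mul_add, add_mul, mul_sub, sub_mul, map_add, map_sub,
    Complex.add_re, Complex.sub_re] at h ⊢
  linarith

lemma tr_sq_le (τ : (H →L[ℂ] H) →ₗ[ℂ] ℂ) (hpos : ∀ a, 0 ≤ τ (star a * a)) (h1 : τ 1 = 1)
    (a : H →L[ℂ] H) : ‖τ a‖ ^ 2 ≤ trq τ a := by
  have h := trq_nonneg τ hpos (a - (τ a) • 1)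
  simp only [trq, star_sub, star_smul, star_one, mul_sub, sub_mul, map_sub, smul_mul_assoc,
    mul_smul_comm, one_mul, mul_one, map_smul, smul_eq_mul, tr_star τ hpos a, h1,
    Complex.star_def, Complex.sub_re, Complex.mul_re, Complex.conj_re, Complex.conj_im] at h
  rw [← Complex.normSq_eq_norm_sq, Complex.normSq_apply]
  simp only [trq]
  linarith

lemma trq_mul_le (τ : (H →L[ℂ] H) →ₗ[ℂ] ℂ) (hpos : ∀ a, 0 ≤ τ (star a * a))
    (b a : H →L[ℂ] H) : trq τ (b * a) ≤ ‖b‖ ^ 2 * trq τ a := by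
  have hb : star b * b ≤ algebraMap ℝ (H →L[ℂ] H) (‖b‖ ^ 2) :=
    CStarAlgebra.star_mul_le_algebraMap_norm_sq
  obtain ⟨s, hs⟩ := CStarAlgebra.nonneg_iff_eq_star_mul_self.1 (sub_nonneg.2 hb)
  have h := trq_nonneg τ hpos (s * a)
  have e : star (s * a) * (s * a) = ((‖b‖ ^ 2 : ℝ) : ℂ) • (star a * a) - star (b * a) * (b * a) := by
    rw [star_mul, star_mul]
    calc star a * star s * (s * a) = star a * (star s * s) * a := by noncomm_ring
      _ = _ := by
        rw [← hs, mul_sub, sub_mul, Algebra.algebraMap_eq_smul_one]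
        simp only [mul_smul_comm, smul_mul_assoc, mul_one, Complex.coe_smul, mul_assoc]
  simp only [trq] at h ⊢
  rw [e, map_sub, map_smul, smul_eq_mul, Complex.sub_re, Complex.re_ofReal_mul] at h
  linarith

lemma trq_le_norm (τ : (H →L[ℂ] H) →ₗ[ℂ] ℂ) (hpos : ∀ a, 0 ≤ τ (star a * a)) (h1 : τ 1 = 1)
    (a : H →L[ℂ] H) : trq τ a ≤ ‖a‖ ^ 2 := by
  have := trq_mul_le τ hpos a 1
  have h2 : trq τ 1 = 1 := by simp [trq, h1]
  rwa [mul_one, h2, mul_one] at this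

lemma tr_continuous (τ : (H →L[ℂ] H) →ₗ[ℂ] ℂ) (hpos : ∀ a, 0 ≤ τ (star a * a)) (h1 : τ 1 = 1) :
    Continuous τ :=
  AddMonoidHomClass.continuous_of_bound τ 1 fun a => by
    have := (tr_sq_le τ hpos h1 a).trans (trq_le_norm τ hpos h1 a)
    rw [one_mul]
    exact le_of_sq_le_sq this (norm_nonneg _)

lemma trq_star (M : VonNeumannAlgebra H) (τ : (H →L[ℂ] H) →ₗ[ℂ] ℂ)
    (htr : ∀ a ∈ M, ∀ b ∈ M, τ (a * b) = τ (b * a)) {a : H →L[ℂ] H} (ha : a ∈ M) :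
    trq τ (star a) = trq τ a := by
  rw [trq, trq, star_star, htr _ ha _ (star_mem ha)]

lemma trq_mul_le_right (M : VonNeumannAlgebra H) (τ : (H →L[ℂ] H) →ₗ[ℂ] ℂ)
    (hpos : ∀ a, 0 ≤ τ (star a * a))
    (htr : ∀ a ∈ M, ∀ b ∈ M, τ (a * b) = τ (b * a)) {a b : H →L[ℂ] H} (ha : a ∈ M) (hb : b ∈ M) :
    trq τ (a * b) ≤ ‖b‖ ^ 2 * trq τ a := by
  rw [← trq_star M τ htr (mul_mem ha hb), star_mul, ← trq_star M τ htr ha, ← norm_star b]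
  exact trq_mul_le τ hpos _ _

/-- The unitary orbit. -/
abbrev uorb (M : VonNeumannAlgebra H) (y : H →L[ℂ] H) : Set (H →L[ℂ] H) :=
  {z | ∃ u ∈ unitary (H →L[ℂ] H), u ∈ M ∧ z = star u * y * u}

lemma trq_orbit (M : VonNeumannAlgebra H) (τ : (H →L[ℂ] H) →ₗ[ℂ] ℂ)
    (htr : ∀ a ∈ M, ∀ b ∈ M, τ (a * b) = τ (b * a)) {x y z : H →L[ℂ] H}
    (hpos : ∀ a, 0 ≤ τ (star a * a))
    (hy : y ∈ M) (hz : z ∈ uorb M y) :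
    trq τ (x - z) = trq τ y - 2 * (τ (star x * z)).re + trq τ x := by
  obtain ⟨u, hu, huM, rfl⟩ := hz
  set z := star u * y * u with hz
  have hu' : u * star u = 1 := (Unitary.mem_iff.1 hu).2
  have e1 : τ (star z * z) = τ (star y * y) := by
    have : star z * z = star u * (star y * y * u) := by
      rw [hz]
      simp only [star_mul, star_star]
      calc star u * (star y * u) * (star u * y * u) = star u * star y * (u * star u) * y * u := by
            noncomm_ring
        _ = _ := by rw [hu']; noncomm_ring
    rw [this, htr _ (star_mem huM) _ (mul_mem (mul_mem (star_mem hy) hy) huM), mul_assoc, hu',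
      mul_one]
  have e2 : τ (star z * x) = star (τ (star x * z)) := by
    rw [← tr_star τ hpos, star_mul (star x) z, star_star]
  simp only [trq, star_sub, mul_sub, sub_mul, map_sub, Complex.sub_re]
  rw [e1, e2]
  simp only [Complex.star_def, Complex.conj_re]
  ring

lemma orbit_bound (M : VonNeumannAlgebra H) (τ : (H →L[ℂ] H) →ₗ[ℂ] ℂ)
    (h1 : τ 1 = 1)
    (htr : ∀ a ∈ M, ∀ b ∈ M, τ (a * b) = τ (b * a)) {x y : H →L[ℂ] H}
    (hpos : ∀ a, 0 ≤ τ (star a * a))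
    (hy : y ∈ M) (hxy : x ∈ closure (convexHull ℝ (uorb M y))) (ε : ℝ)
    (h : ∀ z ∈ uorb M y, ε ≤ trq τ (x - z)) : ε ≤ trq τ y - trq τ x := by
  let S : Set (H →L[ℂ] H) := {z | 2 * (τ (star x * z)).re ≤ trq τ y + trq τ x - ε}
  have hc : Continuous τ := tr_continuous τ hpos h1
  have hS : IsClosed S := isClosed_le (by fun_prop) continuous_const
  have hconv : Convex ℝ S := by
    intro a ha b hb s t hs ht hst
    simp only [S, Set.mem_ofPred_eq] at ha hb ⊢
    rw [mul_add, mul_smul_comm, mul_smul_comm, ← Complex.coe_smul, ← Complex.coe_smul, map_add,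
      map_smul, map_smul, smul_eq_mul, smul_eq_mul, Complex.add_re, Complex.re_ofReal_mul,
      Complex.re_ofReal_mul]
    obtain rfl : t = 1 - s := by linarith
    nlinarith [mul_le_mul_of_nonneg_left ha hs, mul_le_mul_of_nonneg_left hb ht]
  have hsub : uorb M y ⊆ S := fun z hz => by
    have := h z hz
    rw [trq_orbit M τ htr hpos hy hz] at this
    simp only [S, Set.mem_ofPred_eq]
    linarith
  have hx : x ∈ S := closure_minimal (convexHull_min hsub hconv) hS hxy
  simp only [S, Set.mem_ofPred_eq] at hx
  simp only [trq] at hx ⊢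
  linarith

lemma exists_close (M : VonNeumannAlgebra H) (τ : (H →L[ℂ] H) →ₗ[ℂ] ℂ)
    (h1 : τ 1 = 1)
    (htr : ∀ a ∈ M, ∀ b ∈ M, τ (a * b) = τ (b * a)) {x y : H →L[ℂ] H}
    (hpos : ∀ a, 0 ≤ τ (star a * a)) (hx : x ∈ M)
    (hy : y ∈ M) (hxy : x ∈ closure (convexHull ℝ (uorb M y)))
    (hyx : y ∈ closure (convexHull ℝ (uorb M x))) (ε : ℝ) (hε : 0 < ε) :
    ∃ u ∈ unitary (H →L[ℂ] H), u ∈ M ∧ trq τ (x - star u * y * u) < ε := by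
  by_contra! hcon
  have a1 := orbit_bound M τ h1 htr hpos hy hxy ε (by
    rintro z ⟨u, hu, huM, rfl⟩
    exact hcon u hu huM)
  have a2 := orbit_bound M τ h1 htr hpos hx hyx 0 (fun z _ => trq_nonneg τ hpos _)
  linarith

lemma cfc_mem_vN (M : VonNeumannAlgebra H) {x : H →L[ℂ] H} (hx : x ∈ M) (f : ℂ → ℂ) :
    cfc f x ∈ M := by
  rw [← VonNeumannAlgebra.commutant_commutant M, VonNeumannAlgebra.mem_commutant_iff]
  intro g hg
  have h1 := VonNeumannAlgebra.mem_commutant_iff.1 hg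
  exact (Commute.cfc (h1 x hx) (h1 _ (star_mem hx)) f).symm.eq

lemma cfcHom_mem_vN (M : VonNeumannAlgebra H) {x : H →L[ℂ] H} (hx : x ∈ M) (hn : IsStarNormal x)
    (f : C(spectrum ℂ x, ℂ)) : cfcHom hn f ∈ M := by
  rw [← VonNeumannAlgebra.commutant_commutant M, VonNeumannAlgebra.mem_commutant_iff]
  intro g hg
  have h1 := VonNeumannAlgebra.mem_commutant_iff.1 hg
  exact (Commute.cfcHom hn (h1 x hx) (h1 _ (star_mem hx)) f).symm.eq

lemma norm_conj_le {u : H →L[ℂ] H} (hu : u ∈ unitary (H →L[ℂ] H)) (b : H →L[ℂ] H) :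
    ‖star u * b * u‖ ≤ ‖b‖ := by
  rw [CStarRing.norm_mul_mem_unitary _ hu,
    CStarRing.norm_mem_unitary_mul _ (Unitary.star_mem hu)]

open Filter Topology in
lemma tendsto_hom (M : VonNeumannAlgebra H) (τ : (H →L[ℂ] H) →ₗ[ℂ] ℂ)
    (h1 : τ 1 = 1)
    (htr : ∀ a ∈ M, ∀ b ∈ M, τ (a * b) = τ (b * a))
    (hpos : ∀ a, 0 ≤ τ (star a * a))
    {K : Set ℂ} [CompactSpace K] (φ ψ : C(K, ℂ) →⋆ₐ[ℂ] (H →L[ℂ] H))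
    (hφM : ∀ f, φ f ∈ M) (hψM : ∀ f, ψ f ∈ M) (u : ℕ → (H →L[ℂ] H))
    (hu : ∀ n, u n ∈ unitary (H →L[ℂ] H)) (huM : ∀ n, u n ∈ M)
    (hid : Tendsto (fun n => trq τ (φ (.restrict K (.id ℂ)) -
      star (u n) * ψ (.restrict K (.id ℂ)) * u n)) atTop (𝓝 0)) (f : C(K, ℂ)) :
    Tendsto (fun n => trq τ (φ f - star (u n) * ψ f * u n)) atTop (𝓝 0) := by
  have hn : ∀ a, 0 ≤ trq τ a := trq_nonneg τ hpos
  have hM : ∀ f n, star (u n) * ψ f * u n ∈ M := fun f n =>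
    mul_mem (mul_mem (star_mem (huM n)) (hψM f)) (huM n)
  have hφn : ∀ f, ‖φ f‖ ≤ ‖f‖ := fun f => NonUnitalStarAlgHom.norm_apply_le φ f
  have hψn : ∀ f, ‖ψ f‖ ≤ ‖f‖ := fun f => NonUnitalStarAlgHom.norm_apply_le ψ f
  induction f using ContinuousMap.induction_on_of_compact with
  | const r =>
    have e : (ContinuousMap.const K r) = algebraMap ℂ C(K, ℂ) r := rfl
    have : ∀ n, trq τ (φ (.const K r) - star (u n) * ψ (.const K r) * u n) = 0 := by
      intro n
      rw [e, AlgHomClass.commutes, AlgHomClass.commutes, Algebra.algebraMap_eq_smul_one,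
        mul_smul_comm, mul_one, smul_mul_assoc, (Unitary.mem_iff.1 (hu n)).1, sub_self]
      simp [trq]
    simp only [this]
    exact tendsto_const_nhds
  | id => exact hid
  | star_id =>
    refine hid.congr fun n => ?_
    rw [← trq_star M τ htr (sub_mem (hφM _) (hM _ n)), star_sub, star_mul, star_mul, star_star,
      map_star, map_star, mul_assoc]
  | add f g hf hg =>
    refine squeeze_zero (fun n => hn _) (fun n => ?_)
      (by simpa using (hf.const_mul 2).add (hg.const_mul 2))
    have e : φ (f + g) - star (u n) * ψ (f + g) * u n =
      (φ f - star (u n) * ψ f * u n) + (φ g - star (u n) * ψ g * u n) := by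
      rw [map_add, map_add]; noncomm_ring
    rw [e]
    exact trq_add_le τ hpos _ _
  | mul f g hf hg =>
    refine squeeze_zero (fun n => hn _)
      (g := fun n => 2 * (‖φ f‖ ^ 2 * trq τ (φ g - star (u n) * ψ g * u n)) +
        2 * (‖ψ g‖ ^ 2 * trq τ (φ f - star (u n) * ψ f * u n))) (fun n => ?_)
      (by simpa using ((hg.const_mul (‖φ f‖ ^ 2)).const_mul 2).add
            ((hf.const_mul (‖ψ g‖ ^ 2)).const_mul 2))
    have hu' : u n * star (u n) = 1 := (Unitary.mem_iff.1 (hu n)).2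
    have e0 : star (u n) * ψ f * u n * (star (u n) * ψ g * u n) =
        star (u n) * (ψ f * ψ g) * u n := by
      calc _ = star (u n) * ψ f * (u n * star (u n)) * ψ g * u n := by noncomm_ring
        _ = _ := by rw [hu']; noncomm_ring
    have e : φ (f * g) - star (u n) * ψ (f * g) * u n =
      φ f * (φ g - star (u n) * ψ g * u n) +
        (φ f - star (u n) * ψ f * u n) * (star (u n) * ψ g * u n) := by
      rw [map_mul, map_mul, sub_mul, e0]; noncomm_ring
    rw [e]
    refine (trq_add_le τ hpos _ _).trans ?_
    have b1 := trq_mul_le τ hpos (φ f) (φ g - star (u n) * ψ g * u n)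
    have b2 := trq_mul_le_right M τ hpos htr (sub_mem (hφM f) (hM f n)) (hM g n)
    have b3 : ‖star (u n) * ψ g * u n‖ ^ 2 ≤ ‖ψ g‖ ^ 2 :=
      pow_le_pow_left₀ (norm_nonneg _) (norm_conj_le (hu n) _) 2
    have b4 := mul_le_mul_of_nonneg_right b3 (hn (φ f - star (u n) * ψ f * u n))
    linarith
  | frequently f hf =>
    rw [Metric.tendsto_atTop]
    intro ε hε
    obtain ⟨δ, hδ, hδε⟩ : ∃ δ : ℝ, 0 < δ ∧ 8 * δ ^ 2 ≤ ε / 2 := by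
      refine ⟨Real.sqrt (ε / 16), by positivity, ?_⟩
      rw [Real.sq_sqrt (by positivity)]; linarith
    obtain ⟨g, hg, hgf⟩ := (hf.and_eventually (Metric.ball_mem_nhds f hδ)).exists
    rw [Metric.tendsto_atTop] at hg
    obtain ⟨N, hN⟩ := hg (ε / 4) (by positivity)
    refine ⟨N, fun n hnN => ?_⟩
    have c := hN n hnN
    rw [Real.dist_eq, sub_zero, abs_of_nonneg (hn _)] at c ⊢
    have hd : ‖f - g‖ ≤ δ := by
      rw [dist_eq_norm, norm_sub_rev] at hgf
      exact hgf.le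
    have e : φ f - star (u n) * ψ f * u n = (φ g - star (u n) * ψ g * u n) +
        (φ (f - g) - star (u n) * ψ (f - g) * u n) := by
      rw [map_sub, map_sub]; noncomm_ring
    have b1 : ‖φ (f - g) - star (u n) * ψ (f - g) * u n‖ ≤ 2 * δ := by
      refine (norm_sub_le _ _).trans ?_
      have := norm_conj_le (hu n) (ψ (f - g))
      have := hφn (f - g)
      have := hψn (f - g)
      linarith
    have b2 := (trq_le_norm τ hpos h1 _).trans (pow_le_pow_left₀ (norm_nonneg _) b1 2)
    have b3 := trq_add_le τ hpos (φ g - star (u n) * ψ g * u n)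
        (φ (f - g) - star (u n) * ψ (f - g) * u n)
    rw [← e] at b3
    nlinarith

open Filter Topology in
lemma trace_cfc_eq (M : VonNeumannAlgebra H) (τ : (H →L[ℂ] H) →ₗ[ℂ] ℂ)
    (h1 : τ 1 = 1)
    (htr : ∀ a ∈ M, ∀ b ∈ M, τ (a * b) = τ (b * a)) {x y : H →L[ℂ] H}
    (hpos : ∀ a, 0 ≤ τ (star a * a)) (hx : x ∈ M)
    (hy : y ∈ M) (hxn : IsStarNormal x) (hyn : IsStarNormal y)
    (hxy : x ∈ closure (convexHull ℝ (uorb M y)))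
    (hyx : y ∈ closure (convexHull ℝ (uorb M x))) (f : ℂ → ℂ) (hf : Continuous f) :
    τ (cfc f x) = τ (cfc f y) := by
  have hex : ∀ n : ℕ, ∃ u ∈ unitary (H →L[ℂ] H), u ∈ M ∧
      trq τ (x - star u * y * u) < 1 / ((n : ℝ) + 1) := fun n =>
    exists_close M τ h1 htr hpos hx hy hxy hyx _ (by positivity)
  choose u hu huM hlt using hex
  let K : Set ℂ := spectrum ℂ x ∪ spectrum ℂ y
  have hK : IsCompact K := (spectrum.isCompact x).union (spectrum.isCompact y)
  have : CompactSpace K := isCompact_iff_compactSpace.1 hK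
  let ix : C(spectrum ℂ x, K) := ⟨Set.inclusion Set.subset_union_left, continuous_inclusion _⟩
  let iy : C(spectrum ℂ y, K) := ⟨Set.inclusion Set.subset_union_right, continuous_inclusion _⟩
  let φ : C(K, ℂ) →⋆ₐ[ℂ] (H →L[ℂ] H) := (cfcHom hxn).comp (ContinuousMap.compStarAlgHom' ℂ ℂ ix)
  let ψ : C(K, ℂ) →⋆ₐ[ℂ] (H →L[ℂ] H) := (cfcHom hyn).comp (ContinuousMap.compStarAlgHom' ℂ ℂ iy)
  have hφid : φ (.restrict K (.id ℂ)) = x := cfcHom_id hxn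
  have hψid : ψ (.restrict K (.id ℂ)) = y := cfcHom_id hyn
  let F : C(K, ℂ) := .restrict K ⟨f, hf⟩
  have hφF : φ F = cfc f x := by
    rw [cfc_apply f x hxn hf.continuousOn]; rfl
  have hψF : ψ F = cfc f y := by
    rw [cfc_apply f y hyn hf.continuousOn]; rfl
  have ht := tendsto_hom M τ h1 htr hpos φ ψ (fun g => cfcHom_mem_vN M hx hxn _)
    (fun g => cfcHom_mem_vN M hy hyn _) u hu huM (by
      rw [hφid, hψid]
      exact squeeze_zero (fun n => trq_nonneg τ hpos _) (fun n => (hlt n).le)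
        tendsto_one_div_add_atTop_nhds_zero_nat) F
  rw [hφF, hψF] at ht
  have hle : ∀ n, ‖τ (cfc f x) - τ (cfc f y)‖ ^ 2 ≤
      trq τ (cfc f x - star (u n) * cfc f y * u n) := by
    intro n
    have e : τ (star (u n) * cfc f y * u n) = τ (cfc f y) := by
      rw [mul_assoc, htr _ (star_mem (huM n)) _ (mul_mem (cfc_mem_vN M hy f) (huM n)), mul_assoc,
        (Unitary.mem_iff.1 (hu n)).2, mul_one]
    rw [← e, ← map_sub]
    exact tr_sq_le τ hpos h1 _
  have h0 : ‖τ (cfc f x) - τ (cfc f y)‖ ^ 2 ≤ 0 := ge_of_tendsto' ht hle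
  have h00 : ‖τ (cfc f x) - τ (cfc f y)‖ = 0 := by
    have := sq_nonneg ‖τ (cfc f x) - τ (cfc f y)‖
    exact pow_eq_zero_iff (two_ne_zero) |>.1 (le_antisymm h0 this)
  exact sub_eq_zero.1 (norm_eq_zero.1 h00)

lemma spectrum_sub (M : VonNeumannAlgebra H) (τ : (H →L[ℂ] H) →ₗ[ℂ] ℂ)
    (h1 : τ 1 = 1) (hfaith : ∀ a ∈ M, τ (star a * a) = 0 → a = 0) {x y : H →L[ℂ] H}
    (hx : x ∈ M) (hxn : IsStarNormal x)
    (h : ∀ f : ℂ → ℂ, Continuous f → τ (cfc f x) = τ (cfc f y)) :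
    spectrum ℂ x ⊆ spectrum ℂ y := by
  have : Nontrivial (H →L[ℂ] H) := by
    refine ⟨1, 0, fun h10 => ?_⟩
    rw [h10, map_zero] at h1
    exact zero_ne_one h1
  intro l hl
  let d : ℂ → ℂ := fun z => (Metric.infDist z (spectrum ℂ y) : ℝ)
  have hd : Continuous d := Complex.continuous_ofReal.comp (Metric.continuous_infDist_pt _)
  have hy0 : cfc (fun z => star (d z) * d z) y = 0 := by
    rw [cfc_congr (g := fun _ => (0 : ℂ)) (fun z hz => by
      simp [d, Metric.infDist_zero_of_mem hz])]
    exact cfc_const_zero ℂ y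
  have e : cfc (fun z => star (d z) * d z) x = star (cfc d x) * cfc d x := by
    rw [cfc_mul _ _ x (by fun_prop) (by fun_prop), cfc_star]
  have hx0 : cfc d x = 0 := by
    apply hfaith _ (cfc_mem_vN M hx d)
    rw [← e, h _ (by fun_prop), hy0, map_zero]
  have hm : d l ∈ spectrum ℂ (cfc d x) := by
    rw [cfc_map_spectrum (R := ℂ) d x hxn hd.continuousOn]
    exact ⟨l, hl, rfl⟩
  rw [hx0, spectrum.zero_eq, Set.mem_singleton_iff] at hm
  have hm' : Metric.infDist l (spectrum ℂ y) = 0 := Complex.ofReal_eq_zero.1 hm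
  exact ((spectrum.isClosed y).mem_iff_infDist_zero (spectrum.nonempty y)).2 hm'

end TraceAux

/-- in a (finite) von Neumann algebra M with a faithful tracial state τ, if
two normal elements x, y lie in the closures of the convex hulls of each other's unitary
orbits, then τ(f(x)) = τ(f(y)) for every continuous function f, and sp(x) = sp(y)
(so the spectral distribution measures coincide). -/
theorem trace_functional_calculus_eq_of_mutual_convexHull
    {H : Type*} [NormedAddCommGroup H] [InnerProductSpace ℂ H] [CompleteSpace H]
    (M : VonNeumannAlgebra H)
    (τ : (H →L[ℂ] H) →ₗ[ℂ] ℂ)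
    (hτ1 : τ 1 = 1) (hτpos : ∀ a, 0 ≤ τ (star a * a))
    (hτtr : ∀ a ∈ M, ∀ b ∈ M, τ (a * b) = τ (b * a))
    (hτfaithful : ∀ a ∈ M, τ (star a * a) = 0 → a = 0)
    (x y : H →L[ℂ] H) (hxM : x ∈ M) (hyM : y ∈ M)
    (hx : IsStarNormal x) (hy : IsStarNormal y)
    (hxy : x ∈ closure (convexHull ℝ
        {z | ∃ u ∈ unitary (H →L[ℂ] H), u ∈ M ∧ z = star u * y * u}))
    (hyx : y ∈ closure (convexHull ℝ
        {z | ∃ u ∈ unitary (H →L[ℂ] H), u ∈ M ∧ z = star u * x * u})) :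
    spectrum ℂ x = spectrum ℂ y ∧
      ∀ f : ℂ → ℂ, Continuous f → τ (cfc f x) = τ (cfc f y) := by
  have key := fun f hf => trace_cfc_eq M τ hτ1 hτtr hτpos hxM hyM hx hy hxy hyx f hf
  exact ⟨Set.Subset.antisymm (spectrum_sub M τ hτ1 hτfaithful hxM hx key)
    (spectrum_sub M τ hτ1 hτfaithful hyM hy (fun f hf => (key f hf).symm)), key⟩
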